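/- Assume the family {P^u}_{u∈(a,b)} satisfies P1–P3 and S1–S2, fix u ∈ (a,b), θ_iso ∈ (0,1), renormalization scales with 4r_0 < l_0, and R ≥ L_0^{3d²/θ_iso}; let s, r and the event H be as defined. Then for every configuration in H there exists a set G ⊆ G_0 ∩ B(0, 2R−L_s) such that: (a) every z ∈ G is 0-good; (b) for any x_s ∈ G_s ∩ B(0, 2R−2L_s), the set G ∩ (x_s+[0,L_s)^d) is connected in G_0 and |G ∩ (x_s+[0,L_s)^d)| ≥ (L_s/L_0)^d · f_d(r_0/l_0); (c) for any x_s ∈ G_s ∩ B(0, 2R−3L_s), any x_0 ∈ G_0 ∩ (x_s+[−L_s,2L_s)^d), any 2 ≤ j ≤ d, and any pairwise orthogonal e_1,…,e_j ∈ Z^d with |e_i|₁ = 1, the j-dimensional slice G ∩ (x_s+[−L_s,2L_s)^d) ∩ (x_0 + Σ_{i=1}^j Z·e_i) is connected in G_0 and has cardinality at least (3L_s/L_0)^j · f_j(r_0/l_0). -/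

import Mathlib

open MeasureTheory Filter
open scoped ENNReal

namespace Perco

/-- A point of the lattice `ℤ^d`. -/
abbrev Pt (d : ℕ) := Fin d → ℤ

/-- A percolation configuration on `ℤ^d`. -/
abbrev Config (d : ℕ) := Pt d → Bool

variable {d : ℕ}

/-- The `ℓ¹`-distance on `ℤ^d`. -/
def dist1 (x y : Pt d) : ℕ := ∑ i, (x i - y i).natAbs

/-- The `ℓ^∞`-distance on `ℤ^d`. -/
def distInf (x y : Pt d) : ℕ := Finset.univ.sup fun i => (x i - y i).natAbs

/-- The closed `ℓ^∞`-ball of radius `R` around `x`. -/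
def ballZ (x : Pt d) (R : ℕ) : Set (Pt d) := {y | distInf x y ≤ R}

/-- Nearest-neighbour adjacency in `ℤ^d`. -/
def adj (x y : Pt d) : Prop := dist1 x y = 1

/-- The occupied set of a configuration. -/
def SS (ω : Config d) : Set (Pt d) := {x | ω x = true}

/-- One step of a nearest-neighbour path staying inside `T`. -/
def stepRel (T : Set (Pt d)) (x y : Pt d) : Prop := adj x y ∧ x ∈ T ∧ y ∈ T

/-- `x` and `y` are connected by a nearest-neighbour path inside `T`. -/
def connIn (T : Set (Pt d)) (x y : Pt d) : Prop :=
  x ∈ T ∧ y ∈ T ∧ Relation.ReflTransGen (stepRel T) x y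

/-- The connected component (cluster) of `x` in `T`. -/
def cluster (T : Set (Pt d)) (x : Pt d) : Set (Pt d) := {y | connIn T x y}

/-- `S_r`: vertices of `S(ω)` in connected components of `ℓ¹`-diameter at least `r`. -/
def Sr (ω : Config d) (r : ℝ) : Set (Pt d) :=
  {x | x ∈ SS ω ∧ ∃ y ∈ cluster (SS ω) x, ∃ z ∈ cluster (SS ω) x, r ≤ (dist1 y z : ℝ)}

/-- `S_∞`: vertices of `S(ω)` in infinite connected components. -/
def Sinf (ω : Config d) : Set (Pt d) := {x | x ∈ SS ω ∧ (cluster (SS ω) x).Infinite}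

/-- The shift of a configuration by `x`. -/
def shift (x : Pt d) (ω : Config d) : Config d := fun y => ω (x + y)

/-- An increasing event. -/
def IncreasingEvent (G : Set (Config d)) : Prop :=
  ∀ ω ω' : Config d, (∀ x, ω x = true → ω' x = true) → ω ∈ G → ω' ∈ G

/-- A decreasing event. -/
def DecreasingEvent (G : Set (Config d)) : Prop :=
  ∀ ω ω' : Config d, (∀ x, ω' x = true → ω x = true) → ω ∈ G → ω' ∈ G

/-- The event `G` depends only on the coordinates in `B`. -/
def DependsOn (G : Set (Config d)) (B : Set (Pt d)) : Prop :=
  ∀ ω ω' : Config d, (∀ x ∈ B, ω x = ω' x) → (ω ∈ G ↔ ω' ∈ G)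

/-- The edge boundary of `A` in `Sset`: (directed representatives of) edges of `ℤ^d`
with one endpoint in `A` and the other in `Sset \ A`. -/
def edgeBd (Sset A : Set (Pt d)) : Set (Pt d × Pt d) :=
  {p | adj p.1 p.2 ∧ p.1 ∈ A ∧ p.2 ∈ Sset \ A}

/-- The density `η(u) = P[0 ∈ S_∞]` of the infinite cluster. -/
noncomputable def eta (d : ℕ) (P : Measure (Config d)) : ℝ :=
  (P {ω | (0 : Pt d) ∈ Sinf ω}).toReal

/-- The first local-uniqueness event of axiom S1. -/
def locUniq1 (d : ℕ) (R : ℕ) : Set (Config d) :=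
  {ω | (Sr ω R ∩ ballZ (0 : Pt d) R).Nonempty}

/-- The second local-uniqueness event of axiom S1. -/
def locUniq2 (d : ℕ) (R : ℕ) : Set (Config d) :=
  {ω | ∀ x ∈ Sr ω ((R : ℝ)/10) ∩ ballZ (0 : Pt d) R,
       ∀ y ∈ Sr ω ((R : ℝ)/10) ∩ ballZ (0 : Pt d) R,
       connIn (SS ω ∩ ballZ (0 : Pt d) (2*R)) x y}

/-- The axioms **P1**–**P3** and **S1**–**S2** of Drewitz–Ráth–Sapozhnikov for a
one-parameter family of probability measures on `{0,1}^{ℤ^d}`. -/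
structure Axioms (d : ℕ) (a b : ℝ) (P : ℝ → Measure (Config d)) where
  /-- decoupling exponent -/
  εP : ℝ
  /-- sprinkling exponent -/
  χP : ℝ
  RP : ℕ
  LP : ℕ
  fP : ℕ → ℝ
  fS : ℝ → ℕ → ℝ
  ΔS : ℝ → ℝ
  RS : ℝ → ℕ
  prob : ∀ u ∈ Set.Ioo a b, IsProbabilityMeasure (P u)
  /-- P1: every lattice shift is measure preserving and ergodic. -/
  ergodic : ∀ u ∈ Set.Ioo a b, ∀ x : Pt d, x ≠ 0 → Ergodic (shift x) (P u)
  /-- P2: monotonicity. -/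
  mono : ∀ u ∈ Set.Ioo a b, ∀ u' ∈ Set.Ioo a b, u ≤ u' →
    ∀ G : Set (Config d), MeasurableSet G → IncreasingEvent G → P u G ≤ P u' G
  εP_pos : 0 < εP
  χP_pos : 0 < χP
  fP_lb : ∀ L : ℕ, LP ≤ L → Real.exp ((Real.log L) ^ εP) ≤ fP L
  /-- P3, decoupling for decreasing events. -/
  decoupleDec : ∀ (R L : ℕ), RP ≤ R → 1 ≤ L → ∀ x₁ x₂ : Pt d, R * L ≤ distInf x₁ x₂ →
    ∀ u uh : ℝ, uh ∈ Set.Ioo a b → u ∈ Set.Ioo a b → uh < u →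
    (1 + (R : ℝ) ^ (-χP)) * uh ≤ u →
    ∀ A₁ A₂ : Set (Config d), MeasurableSet A₁ → MeasurableSet A₂ →
      DecreasingEvent A₁ → DecreasingEvent A₂ →
      DependsOn A₁ (ballZ x₁ (10*L)) → DependsOn A₂ (ballZ x₂ (10*L)) →
      (P u (A₁ ∩ A₂)).toReal ≤ (P uh A₁).toReal * (P uh A₂).toReal + Real.exp (-(fP L))
  /-- P3, decoupling for increasing events. -/
  decoupleInc : ∀ (R L : ℕ), RP ≤ R → 1 ≤ L → ∀ x₁ x₂ : Pt d, R * L ≤ distInf x₁ x₂ →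
    ∀ u uh : ℝ, uh ∈ Set.Ioo a b → u ∈ Set.Ioo a b → uh < u →
    (1 + (R : ℝ) ^ (-χP)) * uh ≤ u →
    ∀ B₁ B₂ : Set (Config d), MeasurableSet B₁ → MeasurableSet B₂ →
      IncreasingEvent B₁ → IncreasingEvent B₂ →
      DependsOn B₁ (ballZ x₁ (10*L)) → DependsOn B₂ (ballZ x₂ (10*L)) →
      (P uh (B₁ ∩ B₂)).toReal ≤ (P u B₁).toReal * (P u B₂).toReal + Real.exp (-(fP L))
  ΔS_pos : ∀ u ∈ Set.Ioo a b, 0 < ΔS u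
  fS_lb : ∀ u ∈ Set.Ioo a b, ∀ R : ℕ, RS u ≤ R → (Real.log R) ^ (1 + ΔS u) ≤ fS u R
  /-- S1, first part. -/
  S1a : ∀ u ∈ Set.Ioo a b, ∀ R : ℕ, 1 ≤ R →
    1 - Real.exp (-(fS u R)) ≤ (P u (locUniq1 d R)).toReal
  /-- S1, second part. -/
  S1b : ∀ u ∈ Set.Ioo a b, ∀ R : ℕ, 1 ≤ R →
    1 - Real.exp (-(fS u R)) ≤ (P u (locUniq2 d R)).toReal
  /-- S2: positivity of the density of the infinite cluster. -/
  S2pos : ∀ u ∈ Set.Ioo a b, 0 < eta d (P u)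
  /-- S2: continuity of the density of the infinite cluster. -/
  S2cont : ContinuousOn (fun u => eta d (P u)) (Set.Ioo a b)


/-! ### Renormalization scales and good/bad boxes -/

/-- The scales `l_k = l_0·4^{k^{θ_sc}}`. -/
def lSc (l0 θsc k : ℕ) : ℕ := l0 * 4 ^ (k ^ θsc)

/-- The scales `r_k = r_0·2^{k^{θ_sc}}`. -/
def rSc (r0 θsc k : ℕ) : ℕ := r0 * 2 ^ (k ^ θsc)

/-- The scales `L_0 = L_0`, `L_{k+1} = l_k·L_k`. -/
def LSc (l0 L0 θsc : ℕ) : ℕ → ℕ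
  | 0 => L0
  | k+1 => lSc l0 θsc k * LSc l0 L0 θsc k

/-- The renormalized lattice `G = L·ℤ^d`. -/
def lattice (d L : ℕ) : Set (Pt d) := {x | ∀ i, (L : ℤ) ∣ x i}

/-- The box `x + [0,n)^d`. -/
def box (x : Pt d) (n : ℕ) : Set (Pt d) := {y | ∀ i, x i ≤ y i ∧ y i < x i + n}

/-- The box `x + [lo,hi)^d`. -/
def boxI (x : Pt d) (lo hi : ℤ) : Set (Pt d) := {y | ∀ i, x i + lo ≤ y i ∧ y i < x i + hi}

/-- The corner `x + e·L_0` of the sub-box indexed by `e ∈ {0,1}^d`. -/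
def subCorner (x : Pt d) (L0 : ℕ) (e : Fin d → Bool) : Pt d :=
  fun i => x i + (if e i then (L0 : ℤ) else 0)

/-- `C` is a connected component of `S_{L0} ∩ B` of cardinality at least `(3/4)·η·L_0^d`. -/
def bigCompIn (ω : Config d) (η : ℝ) (L0 : ℕ) (B : Set (Pt d)) (C : Set (Pt d)) : Prop :=
  (∃ w ∈ Sr ω (L0 : ℝ) ∩ B, C = cluster (Sr ω (L0 : ℝ) ∩ B) w) ∧
  (3/4 : ℝ) * η * (L0 : ℝ) ^ d ≤ C.ncard

/-- The event `A^u_x`: each of the `2^d` sub-boxes of side `L_0` of `x + [0,2L_0)^d` contains a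
connected component of `S_{L_0}` with at least `(3/4)·η·L_0^d` vertices, and all these components
are connected in `S ∩ (x+[0,2L_0)^d)`. -/
def eventA (d : ℕ) (η : ℝ) (L0 : ℕ) (x : Pt d) : Set (Config d) :=
  {ω | (∀ e : Fin d → Bool, ∃ C, bigCompIn ω η L0 (box (subCorner x L0 e) L0) C) ∧
       (∀ e e' : Fin d → Bool, ∀ C C' : Set (Pt d), ∀ y z : Pt d,
          bigCompIn ω η L0 (box (subCorner x L0 e) L0) C →
          bigCompIn ω η L0 (box (subCorner x L0 e') L0) C' →
          y ∈ C → z ∈ C' → connIn (SS ω ∩ box x (2*L0)) y z)}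

/-- The event `B^u_x`: each of the `2^d` sub-boxes of side `L_0` of `x + [0,2L_0)^d` contains at
most `(5/4)·η·L_0^d` vertices of `S_{L_0}`. -/
def eventB (d : ℕ) (η : ℝ) (L0 : ℕ) (x : Pt d) : Set (Config d) :=
  {ω | ∀ e : Fin d → Bool,
    ((Sr ω (L0 : ℝ) ∩ box (subCorner x L0 e) L0).ncard : ℝ) ≤ (5/4 : ℝ) * η * (L0 : ℝ) ^ d}

/-- The recursive cascading of a family of "bad" seed events along the renormalization scheme. -/
def cascade (d : ℕ) (r0 l0 L0 θsc : ℕ) (seed : Pt d → Set (Config d)) :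
    ℕ → Pt d → Set (Config d)
  | 0, x => seed x
  | k+1, x => {ω | ∃ x₁ x₂ : Pt d,
      x₁ ∈ lattice d (LSc l0 L0 θsc k) ∩ box x (LSc l0 L0 θsc (k+1)) ∧
      x₂ ∈ lattice d (LSc l0 L0 θsc k) ∩ box x (LSc l0 L0 θsc (k+1)) ∧
      rSc r0 θsc k * LSc l0 L0 θsc k ≤ distInf x₁ x₂ ∧
      ω ∈ cascade d r0 l0 L0 θsc seed k x₁ ∧ ω ∈ cascade d r0 l0 L0 θsc seed k x₂}

/-- The event `Ā^u_{x,k}`. -/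
def Abar (d : ℕ) (η : ℝ) (r0 l0 L0 θsc : ℕ) : ℕ → Pt d → Set (Config d) :=
  cascade d r0 l0 L0 θsc (fun x => (eventA d η L0 x)ᶜ)

/-- The event `B̄^u_{x,k}`. -/
def Bbar (d : ℕ) (η : ℝ) (r0 l0 L0 θsc : ℕ) : ℕ → Pt d → Set (Config d) :=
  cascade d r0 l0 L0 θsc (fun x => (eventB d η L0 x)ᶜ)

/-- The event that `x ∈ G_k` is `k`-bad. -/
def kBad (d : ℕ) (η : ℝ) (r0 l0 L0 θsc k : ℕ) (x : Pt d) : Set (Config d) :=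
  Abar d η r0 l0 L0 θsc k x ∪ Bbar d η r0 l0 L0 θsc k x

/-- `s` is the largest integer with `L_s^{3d²} ≤ R^{θ_iso}`. -/
def isScaleS (d l0 L0 θsc : ℕ) (θiso : ℝ) (R s : ℕ) : Prop :=
  ((LSc l0 L0 θsc s : ℝ)) ^ (3*d^2) ≤ (R : ℝ) ^ θiso ∧
  ∀ s' : ℕ, ((LSc l0 L0 θsc s' : ℝ)) ^ (3*d^2) ≤ (R : ℝ) ^ θiso → s' ≤ s

/-- The event `H`: (a) every vertex of `G_r ∩ B(0,3R)` is `r`-good, and (b) any two points of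
`S_{L_s}` lying in a common box `z+[−2L_s,2L_s)^d`, `z ∈ B(0,2R)`, are connected inside
`S ∩ (z+[−4L_s,4L_s)^d)`. -/
def eventH (d : ℕ) (η : ℝ) (r0 l0 L0 θsc s r R : ℕ) : Set (Config d) :=
  {ω | (∀ z ∈ lattice d (LSc l0 L0 θsc r) ∩ ballZ (0 : Pt d) (3*R),
          ω ∉ kBad d η r0 l0 L0 θsc r z) ∧
       (∀ z ∈ ballZ (0 : Pt d) (2*R),
          ∀ x ∈ Sr ω ((LSc l0 L0 θsc s : ℕ) : ℝ) ∩
                boxI z (-(2*(LSc l0 L0 θsc s) : ℤ)) (2*(LSc l0 L0 θsc s)),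
          ∀ y ∈ Sr ω ((LSc l0 L0 θsc s : ℕ) : ℝ) ∩
                boxI z (-(2*(LSc l0 L0 θsc s) : ℤ)) (2*(LSc l0 L0 θsc s)),
          connIn (SS ω ∩ boxI z (-(4*(LSc l0 L0 θsc s) : ℤ)) (4*(LSc l0 L0 θsc s))) x y)}

/-- The boundary of `A` within `g`, in the `L`-renormalized lattice: pairs of vertices of `g` at
`ℓ¹`-distance `L` with one vertex in `A` and the other in `g ∖ A`. -/
def bdWithin (L : ℕ) (g A : Set (Pt d)) : Set (Pt d × Pt d) :=
  {p | dist1 p.1 p.2 = L ∧ p.1 ∈ A ∧ p.2 ∈ g \ A}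

/-- One step of an `L`-renormalized nearest-neighbour path inside `T`. -/
def stepRelL (L : ℕ) (T : Set (Pt d)) (x y : Pt d) : Prop :=
  dist1 x y = L ∧ x ∈ T ∧ y ∈ T

/-- `x` and `y` are connected by an `L`-renormalized nearest-neighbour path inside `T`. -/
def connInL (L : ℕ) (T : Set (Pt d)) (x y : Pt d) : Prop :=
  x ∈ T ∧ y ∈ T ∧ Relation.ReflTransGen (stepRelL L T) x y

/-- The set `T` is connected as a subgraph of the `L`-renormalized lattice. -/
def IsConnL (L : ℕ) (T : Set (Pt d)) : Prop := ∀ x ∈ T, ∀ y ∈ T, connInL L T x y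

/-- The infinite product `f_j(r_0/l_0) = ∏_{i=0}^∞ (1 − 3(r_i/l_i)^j)`. -/
noncomputable def fjProd (r0 l0 θsc j : ℕ) : ℝ :=
  ∏' i : ℕ, (1 - 3 * ((rSc r0 θsc i : ℝ) / (lSc l0 θsc i)) ^ j)

/-- The affine sublattice `x₀ + ∑_{i=1}^j ℤ·e_i`. -/
def sliceSpan {j : ℕ} (x0 : Pt d) (e : Fin j → Pt d) : Set (Pt d) :=
  {y | ∃ c : Fin j → ℤ, y = x0 + ∑ i, c i • e i}

/-- The vectors `e_1,…,e_j` are pairwise orthogonal with `|e_i|₁ = 1`. -/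
def orthoUnit {j : ℕ} (e : Fin j → Pt d) : Prop :=
  (∀ i, dist1 (0 : Pt d) (e i) = 1) ∧
  Pairwise fun i i' => (∑ t, (e i t) * (e i' t)) = 0

/-! ### Abstract multiscale scheme in index coordinates -/

lemma dist1_comm' (x y : Pt d) : dist1 x y = dist1 y x := by
  unfold dist1
  refine Finset.sum_congr rfl fun i _ => ?_
  omega

lemma dist1_update (x : Pt d) (k : Fin d) (t : ℤ) :
    dist1 x (Function.update x k t) = (x k - t).natAbs := by
  unfold dist1
  rw [Finset.sum_eq_single k]
  · simp
  · intro b _ hb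
    simp [Function.update_of_ne hb]
  · simp

lemma dist1_update_lt (x y : Pt d) (k : Fin d) (t : ℤ)
    (h : (t - y k).natAbs < (x k - y k).natAbs) :
    dist1 (Function.update x k t) y < dist1 x y := by
  unfold dist1
  refine Finset.sum_lt_sum (fun i _ => ?_) ⟨k, Finset.mem_univ _, ?_⟩
  · by_cases hi : i = k
    · subst hi; simp; omega
    · simp [Function.update_of_ne hi]
  · simpa using h

lemma stepRelL_symm {L : ℕ} {T : Set (Pt d)} : ∀ x y, stepRelL L T x y → stepRelL L T y x := by
  rintro x y ⟨h, hx, hy⟩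
  exact ⟨by rw [dist1_comm']; exact h, hy, hx⟩

lemma mem_uIcc_pi {x y z : Pt d} : z ∈ Set.uIcc x y ↔ ∀ i, z i ∈ Set.uIcc (x i) (y i) := by
  simp only [Set.uIcc, Set.mem_Icc, Pi.le_def, Pi.inf_apply, Pi.sup_apply]
  exact ⟨fun h i => ⟨h.1 i, h.2 i⟩, fun h => ⟨fun i => (h i).1, fun i => (h i).2⟩⟩

lemma cuboid_conn (K : Set (Pt d)) : ∀ n : ℕ, ∀ x y : Pt d, dist1 x y = n →
    Set.uIcc x y ⊆ K → Relation.ReflTransGen (stepRelL 1 K) x y := by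
  intro n
  induction n using Nat.strong_induction_on with
  | _ n ih =>
    intro x y hn hK
    by_cases hxy : x = y
    · subst hxy; exact Relation.ReflTransGen.refl
    · obtain ⟨k, hk⟩ := Function.ne_iff.mp hxy
      obtain ⟨t, ht1, ht2, ht3⟩ : ∃ t : ℤ, (x k - t).natAbs = 1 ∧
          (t - y k).natAbs < (x k - y k).natAbs ∧ t ∈ Set.uIcc (x k) (y k) := by
        rcases lt_or_gt_of_ne hk with h | h
        · exact ⟨x k + 1, by omega, by omega, by rw [Set.mem_uIcc]; omega⟩
        · exact ⟨x k - 1, by omega, by omega, by rw [Set.mem_uIcc]; omega⟩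
      have hmem : Function.update x k t ∈ Set.uIcc x y := by
        rw [mem_uIcc_pi]
        intro i
        by_cases hi : i = k
        · subst hi; simpa using ht3
        · simp [Function.update_of_ne hi]
      refine Relation.ReflTransGen.head (b := Function.update x k t) ⟨?_, hK Set.left_mem_uIcc, hK hmem⟩ ?_
      · rw [dist1_update]; exact ht1
      · refine ih _ ?_ _ _ rfl ((Set.uIcc_subset_uIcc_right hmem).trans hK)
        rw [← hn]; exact dist1_update_lt x y k t ht2

lemma interval_data (a b lo : ℤ) (l r : ℕ) (h : 4 * r < l) :
    ∃ v c : ℤ, lo ≤ v ∧ v < lo + l ∧ v ∉ Finset.Ico a (a + r) ∧ v ∉ Finset.Ico b (b + r) ∧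
      (c = a ∨ c = b) ∧
      ∀ x ∈ Finset.Ico a (a + r) ∪ Finset.Ico b (b + r), ∀ y ∈ Set.uIcc x v,
        y ∈ Finset.Ico c (c + r) → x ∈ Finset.Ico c (c + r) := by
  simp only [Finset.mem_union, Finset.mem_Ico, Set.mem_uIcc]
  obtain ⟨v, h1, h2, h3, h4⟩ : ∃ v : ℤ, lo ≤ v ∧ v < lo + l ∧ ¬ (a ≤ v ∧ v < a + r) ∧
      ¬ (b ≤ v ∧ v < b + r) := by
    by_contra hc
    push Not at hc
    have e1 := hc lo
    have e2 := hc (lo + r)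
    have e3 := hc (lo + 2 * r)
    omega
  refine ⟨v, if a + r ≤ v ∧ b + r ≤ v then min a b else
    if v < a ∧ v < b then max a b else a, h1, h2, h3, h4, ?_, ?_⟩
  · split_ifs <;> omega
  · intro x hx y hy hyc
    split_ifs at hyc ⊢ <;> omega

/-- A renormalization scheme in index coordinates. -/
structure Scheme (d : ℕ) where
  l : ℕ → ℕ
  r : ℕ → ℕ
  hl : ∀ k, 4 * r k < l k
  bad : ℕ → Pt d → Prop
  A : ℕ → Pt d → Fin d → Finset ℤ
  B : ℕ → Pt d → Fin d → Finset ℤ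
  C : ℕ → Pt d → Fin d → Finset ℤ
  v : ℕ → Pt d → Pt d
  cA : ∀ k p i, (A k p i).card ≤ r k
  cB : ∀ k p i, (B k p i).card ≤ r k
  hC : ∀ k p i, C k p i = A k p i ∨ C k p i = B k p i
  hv : ∀ k p i, v k p i / l k = p i
  hvA : ∀ k p i, v k p i ∉ A k p i
  hvB : ∀ k p i, v k p i ∉ B k p i
  hdir : ∀ k p i, ∀ x ∈ A k p i ∪ B k p i, ∀ y ∈ Set.uIcc x (v k p i),
    y ∈ C k p i → x ∈ C k p i
  hbad : ∀ k p, ¬ bad (k+1) p → ∀ q : Pt d, (∀ i, q i / l k = p i) → bad k q →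
    (∀ i, q i ∈ A k p i) ∨ (∀ i, q i ∈ B k p i)

namespace Scheme

variable (S : Scheme d)

lemma lpos (k : ℕ) : (0 : ℤ) < S.l k := by have := S.hl k; omega

/-- Retained children. -/
noncomputable def K (k : ℕ) (p : Pt d) : Finset (Pt d) :=
  (Fintype.piFinset fun i => Finset.Ico ((S.l k : ℤ) * p i) (S.l k * p i + S.l k)) \
    (Fintype.piFinset (S.A k p) ∪ Fintype.piFinset (S.B k p) ∪ Fintype.piFinset (S.C k p))

lemma mem_Ico_iff (k : ℕ) (t u : ℤ) :
    t ∈ Finset.Ico ((S.l k : ℤ) * u) (S.l k * u + S.l k) ↔ t / S.l k = u := by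
  rw [Finset.mem_Ico, Int.ediv_eq_iff_of_pos (S.lpos k)]
  constructor <;> rintro ⟨h1, h2⟩ <;> constructor <;> nlinarith

lemma mem_K {k : ℕ} {p q : Pt d} : q ∈ S.K k p ↔ (∀ i, q i / S.l k = p i) ∧
    ¬ (∀ i, q i ∈ S.A k p i) ∧ ¬ (∀ i, q i ∈ S.B k p i) ∧ ¬ (∀ i, q i ∈ S.C k p i) := by
  simp only [K, Finset.mem_sdiff, Finset.mem_union, Fintype.mem_piFinset, mem_Ico_iff]
  tauto

/-- Retained level-0 cells in a level `n` cell. -/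
noncomputable def Ret : ℕ → Pt d → Finset (Pt d)
  | 0, p => {p}
  | n+1, p => (S.K n p).biUnion (Ret n)

def D (n : ℕ) : ℕ := ∏ i ∈ Finset.range n, S.l i

def idx (n : ℕ) (m : Pt d) : Pt d := fun i => m i / (S.D n : ℤ)

lemma D_zero : S.D 0 = 1 := by simp [D]

lemma D_succ (n : ℕ) : S.D (n+1) = S.D n * S.l n := by simp [D, Finset.prod_range_succ]

lemma idx_zero (m : Pt d) : S.idx 0 m = m := by
  funext i; simp [idx, D_zero]

lemma idx_succ (n : ℕ) (m : Pt d) (i : Fin d) : S.idx (n+1) m i = S.idx n m i / S.l n := by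
  simp only [idx, D_succ]
  push_cast
  rw [Int.ediv_ediv_of_nonneg]
  exact Int.natCast_nonneg _

lemma idx_of_Ret : ∀ {n : ℕ} {p m : Pt d}, m ∈ S.Ret n p → S.idx n m = p
  | 0, p, m, h => by
      simp only [Ret, Finset.mem_singleton] at h; rw [idx_zero, h]
  | n+1, p, m, h => by
      simp only [Ret, Finset.mem_biUnion] at h
      obtain ⟨q, hq, hm⟩ := h
      funext i
      rw [idx_succ, idx_of_Ret hm]
      exact (S.mem_K.mp hq).1 i

lemma good_K {k : ℕ} {p q : Pt d} (hp : ¬ S.bad (k+1) p) (hq : q ∈ S.K k p) : ¬ S.bad k q := by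
  intro hb
  obtain ⟨h1, h2, h3, _⟩ := S.mem_K.mp hq
  exact (S.hbad k p hp q h1 hb).elim h2 h3

lemma good_of_Ret : ∀ {n : ℕ} {p m : Pt d}, ¬ S.bad n p → m ∈ S.Ret n p → ¬ S.bad 0 m
  | 0, p, m, hp, h => by
      simp only [Ret, Finset.mem_singleton] at h; rw [h]; exact hp
  | n+1, p, m, hp, h => by
      simp only [Ret, Finset.mem_biUnion] at h
      obtain ⟨q, hq, hm⟩ := h
      exact good_of_Ret (S.good_K hp hq) hm

/-- free coordinate implies not removed -/
lemma mem_K_of_free {k : ℕ} {p q : Pt d} (h : ∀ i, q i / S.l k = p i) (i : Fin d)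
    (hA : q i ∉ S.A k p i) (hB : q i ∉ S.B k p i) : q ∈ S.K k p := by
  rw [mem_K]
  refine ⟨h, fun h => hA (h i), fun h => hB (h i), fun h => ?_⟩
  rcases S.hC k p i with e | e
  · exact hA (e ▸ h i)
  · exact hB (e ▸ h i)

lemma glue (J : Finset (Fin d)) (hJ : 2 ≤ J.card) (x0 : Pt d) (i : Fin d) (hi : i ∈ J) :
    ∀ (n : ℕ) (p : Pt d), (∀ t, t ∉ J → p t = S.idx n x0 t) →
    ∃ m ∈ S.Ret n p, ∃ m' ∈ S.Ret n (Function.update p i (p i + 1)),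
      (∀ t, t ∉ J → m t = x0 t) ∧ m' = Function.update m i (m i + 1)
  | 0, p, h => by
      refine ⟨p, by simp [Ret], _, by simp [Ret], fun t ht => ?_, rfl⟩
      rw [h t ht, idx_zero]
  | n+1, p, h => by
      set p' := Function.update p i (p i + 1) with hp'
      obtain ⟨k, hk, hki⟩ := Finset.exists_mem_ne (by omega) i (s := J)
      have hlp := S.lpos n
      obtain ⟨t, ht⟩ : ∃ t, t ∈ Finset.Ico ((S.l n : ℤ) * p k) (S.l n * p k + S.l n) \
          ((S.A n p k ∪ S.B n p k) ∪ (S.A n p' k ∪ S.B n p' k)) := by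
        apply Finset.card_pos.mp
        have h1 := Finset.le_card_sdiff ((S.A n p k ∪ S.B n p k) ∪ (S.A n p' k ∪ S.B n p' k))
          (Finset.Ico ((S.l n : ℤ) * p k) (S.l n * p k + S.l n))
        have h2 := Finset.card_union_le (S.A n p k ∪ S.B n p k) (S.A n p' k ∪ S.B n p' k)
        have h3 := Finset.card_union_le (S.A n p k) (S.B n p k)
        have h4 := Finset.card_union_le (S.A n p' k) (S.B n p' k)
        have h5 := S.cA n p k
        have h6 := S.cA n p' k
        have h7 := S.cB n p k
        have h8 := S.cB n p' k
        have h9 := S.hl n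
        rw [Int.card_Ico] at h1
        omega
      simp only [Finset.mem_sdiff, mem_Ico_iff, Finset.mem_union, not_or] at ht
      obtain ⟨ht0, ⟨htA, htB⟩, htA', htB'⟩ := ht
      let q : Pt d := fun s => if s = i then S.l n * p i + S.l n - 1 else
        if s = k then t else if s ∈ J then S.l n * p s else S.idx n x0 s
      have hqk : q k = t := by simp [q, hki]
      have hqi : q i = S.l n * p i + S.l n - 1 := by simp [q]
      have hq : ∀ s, q s / S.l n = p s := by
        intro s
        simp only [q]
        split_ifs with h1 h2 h3
        · subst h1
          rw [← mem_Ico_iff, Finset.mem_Ico]; omega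
        · subst h2; exact ht0
        · rw [← mem_Ico_iff, Finset.mem_Ico]; omega
        · rw [h s h3, idx_succ]
      have hq' : ∀ s, (Function.update q i (q i + 1)) s / S.l n = p' s := by
        intro s
        by_cases hs : s = i
        · subst hs
          rw [← mem_Ico_iff, Finset.mem_Ico]
          simp only [Function.update_self, hqi, hp']
          constructor <;> nlinarith
        · rw [hp', Function.update_of_ne hs, Function.update_of_ne hs]; exact hq s
      have hqJ : ∀ s, s ∉ J → q s = S.idx n x0 s := by
        intro s hs
        have h1 : s ≠ i := fun e => hs (e ▸ hi)
        have h2 : s ≠ k := fun e => hs (e ▸ hk)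
        simp [q, h1, h2, hs]
      obtain ⟨m, hm, m', hm', hmJ, e⟩ := glue J hJ x0 i hi n q hqJ
      refine ⟨m, ?_, m', ?_, hmJ, e⟩
      · simp only [Ret, Finset.mem_biUnion]
        exact ⟨q, S.mem_K_of_free hq k (hqk ▸ htA) (hqk ▸ htB), hm⟩
      · simp only [Ret, Finset.mem_biUnion]
        refine ⟨_, S.mem_K_of_free hq' k ?_ ?_, hm'⟩ <;>
        · rw [Function.update_of_ne hki, hqk]; assumption

/-- Retained children in the slice. -/
def KJ (J : Finset (Fin d)) (k : ℕ) (p y : Pt d) : Set (Pt d) :=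
  {q | q ∈ S.K k p ∧ ∀ t, t ∉ J → q t = y t}

lemma ediv_uIcc {k : ℕ} {a b c u : ℤ} (ha : a / S.l k = u) (hb : b / S.l k = u)
    (hc : c ∈ Set.uIcc a b) : c / S.l k = u := by
  rw [← mem_Ico_iff, Finset.mem_Ico] at *
  rw [Set.mem_uIcc] at hc
  omega

/-- Two points sharing a free coordinate are connected. -/
lemma free_conn (J : Finset (Fin d)) {k : ℕ} {p y q q' : Pt d}
    (hq : ∀ i, q i / S.l k = p i) (hq' : ∀ i, q' i / S.l k = p i)
    (hJ : ∀ t, t ∉ J → q t = y t) (hJ' : ∀ t, t ∉ J → q' t = y t)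
    (i : Fin d) (e : q i = q' i) (hA : q i ∉ S.A k p i) (hB : q i ∉ S.B k p i) :
    Relation.ReflTransGen (stepRelL 1 (S.KJ J k p y)) q q' := by
  refine cuboid_conn _ _ q q' rfl ?_
  intro z hz
  rw [mem_uIcc_pi] at hz
  have hzi : z i = q i := by
    have := hz i
    rw [← e] at this
    simpa using this
  refine ⟨S.mem_K_of_free (fun s => S.ediv_uIcc (hq s) (hq' s) (hz s)) i
    (hzi ▸ hA) (hzi ▸ hB), fun t ht => ?_⟩
  have := hz t
  rw [hJ t ht, hJ' t ht] at this
  simpa using this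

lemma seg {x : Pt d} {i : Fin d} {t : ℤ} {z : Pt d}
    (hz : z ∈ Set.uIcc x (Function.update x i t)) :
    z i ∈ Set.uIcc (x i) t ∧ ∀ s, s ≠ i → z s = x s := by
  rw [mem_uIcc_pi] at hz
  refine ⟨by simpa using hz i, fun s hs => ?_⟩
  have := hz s
  rw [Function.update_of_ne hs] at this
  simpa using this

lemma to_free (J : Finset (Fin d)) (hJ : 2 ≤ J.card) {k : ℕ} {p y q : Pt d}
    (hq : q ∈ S.KJ J k p y) :
    ∃ i ∈ J, ∃ w ∈ S.KJ J k p y, w i ∉ S.A k p i ∧ w i ∉ S.B k p i ∧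
      Relation.ReflTransGen (stepRelL 1 (S.KJ J k p y)) q w := by
  by_contra hcon
  push Not at hcon
  obtain ⟨hqK, hqJ⟩ := hq
  obtain ⟨hq0, hqA, hqB, hqC⟩ := S.mem_K.mp hqK
  have hnf : ∀ i ∈ J, q i ∈ S.A k p i ∪ S.B k p i := by
    intro i hi
    by_contra h
    rw [Finset.mem_union, not_or] at h
    exact hcon i hi q ⟨hqK, hqJ⟩ h.1 h.2 Relation.ReflTransGen.refl
  -- moving towards `v` in any direction of `J` is blocked
  have hblock : ∀ i ∈ J, ∃ z : Pt d, z i ∈ Set.uIcc (q i) (S.v k p i) ∧ (∀ s, s ≠ i → z s = q s) ∧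
      ((∀ s, z s ∈ S.A k p s) ∨ (∀ s, z s ∈ S.B k p s)) := by
    intro i hi
    by_contra hno
    push Not at hno
    have hsub : Set.uIcc q (Function.update q i (S.v k p i)) ⊆ S.KJ J k p y := by
      intro z hz
      obtain ⟨h1, h2⟩ := seg hz
      obtain ⟨n1, n2⟩ := hno z h1 h2
      refine ⟨S.mem_K.mpr ⟨fun s => ?_, ?_, ?_, ?_⟩, fun t ht => ?_⟩
      · by_cases hs : s = i
        · subst hs; exact S.ediv_uIcc (hq0 s) (S.hv k p s) h1
        · rw [h2 s hs]; exact hq0 s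
      · push Not; exact n1
      · push Not; exact n2
      · intro hzC
        apply hqC
        intro s
        by_cases hs : s = i
        · subst hs
          exact S.hdir k p s _ (hnf s hi) _ h1 (hzC s)
        · rw [← h2 s hs]; exact hzC s
      · rw [h2 t (fun e => ht (e ▸ hi))]; exact hqJ t ht
    refine hcon i hi (Function.update q i (S.v k p i)) (hsub Set.right_mem_uIcc) ?_ ?_
      (cuboid_conn _ _ _ _ rfl hsub)
    · simpa using S.hvA k p i
    · simpa using S.hvB k p i
  obtain ⟨i, hi, j, hj, hij⟩ := Finset.one_lt_card.mp (show 1 < J.card by omega)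
  obtain ⟨z, z1, z2, z3⟩ := hblock i hi
  obtain ⟨w, w1, w2, w3⟩ := hblock j hj
  have hzj := z2 j hij.symm
  have hwi := w2 i hij
  -- the two obstacles are distinct
  have key : ∀ X Y : Fin d → Finset ℤ,
      (∀ s, S.C k p s = X s ∨ S.C k p s = Y s) →
      ¬ (∀ s, q s ∈ X s) → ¬ (∀ s, q s ∈ Y s) →
      (∀ s, z s ∈ X s) → (∀ s, w s ∈ Y s) → False := by
    intro X Y hC hX hY hzX hwY
    have hiX : q i ∉ X i := by
      intro h
      apply hX
      intro s
      by_cases hs : s = i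
      · subst hs; exact h
      · rw [← z2 s hs]; exact hzX s
    have hjY : q j ∉ Y j := by
      intro h
      apply hY
      intro s
      by_cases hs : s = j
      · subst hs; exact h
      · rw [← w2 s hs]; exact hwY s
    apply hqC
    intro s
    by_cases hsi : s = i
    · subst hsi
      rcases hC s with e | e
      · exact S.hdir k p s _ (hnf s hi) _ z1 (e ▸ hzX s)
      · rw [e, ← hwi]; exact hwY s
    · by_cases hsj : s = j
      · subst hsj
        rcases hC s with e | e
        · rw [e, ← hzj]; exact hzX s
        · exact S.hdir k p s _ (hnf s hj) _ w1 (e ▸ hwY s)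
      · rcases hC s with e | e
        · rw [e, ← z2 s hsi]; exact hzX s
        · rw [e, ← w2 s hsj]; exact hwY s
  have same : ∀ X : Fin d → Finset ℤ, (∀ s, z s ∈ X s) → (∀ s, w s ∈ X s) → ∀ s, q s ∈ X s := by
    intro X hz hw s
    by_cases hs : s = i
    · subst hs; rw [← hwi]; exact hw s
    · rw [← z2 s hs]; exact hz s
  rcases z3 with hz | hz <;> rcases w3 with hw | hw
  · exact hqA (same _ hz hw)
  · exact key _ _ (S.hC k p) hqA hqB hz hw
  · exact key _ _ (fun s => (S.hC k p s).symm) hqB hqA hz hw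
  · exact hqB (same _ hz hw)

lemma rtg_symm {L : ℕ} {T : Set (Pt d)} {x y : Pt d}
    (h : Relation.ReflTransGen (stepRelL L T) x y) :
    Relation.ReflTransGen (stepRelL L T) y x := by
  induction h with
  | refl => exact Relation.ReflTransGen.refl
  | tail _ h ih => exact Relation.ReflTransGen.head (stepRelL_symm _ _ h) ih

lemma cell_conn (J : Finset (Fin d)) (hJ : 2 ≤ J.card) {k : ℕ} {p y q q' : Pt d}
    (hq : q ∈ S.KJ J k p y) (hq' : q' ∈ S.KJ J k p y) :
    Relation.ReflTransGen (stepRelL 1 (S.KJ J k p y)) q q' := by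
  have hy : ∀ t, t ∉ J → y t / S.l k = p t := by
    intro t ht
    rw [← hq.2 t ht]; exact (S.mem_K.mp hq.1).1 t
  let c : Pt d := fun s => if s ∈ J then S.v k p s else y s
  have hc : ∀ s, c s / S.l k = p s := by
    intro s
    by_cases hs : s ∈ J
    · simp only [c, hs, if_true]; exact S.hv k p s
    · simp only [c, hs, if_false]; exact hy s hs
  have hcJ : ∀ s, s ∉ J → c s = y s := by intro s hs; simp [c, hs]
  have main : ∀ q ∈ S.KJ J k p y, Relation.ReflTransGen (stepRelL 1 (S.KJ J k p y)) q c := by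
    intro q hq
    obtain ⟨i, hi, w, hw, hwA, hwB, hqw⟩ := S.to_free J hJ hq
    refine hqw.trans ?_
    obtain ⟨j, hj, hji⟩ := Finset.exists_mem_ne (by omega) i (s := J)
    have hw0 := (S.mem_K.mp hw.1).1
    let c' := Function.update c i (w i)
    have hc' : ∀ s, c' s / S.l k = p s := by
      intro s
      by_cases hs : s = i
      · subst hs; simp only [c', Function.update_self]; exact hw0 s
      · simp only [c', Function.update_of_ne hs]; exact hc s
    have hc'J : ∀ s, s ∉ J → c' s = y s := by
      intro s hs
      have : s ≠ i := fun e => hs (e ▸ hi)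
      simp only [c', Function.update_of_ne this]; exact hcJ s hs
    have hcj : c j = S.v k p j := by simp [c, hj]
    have hc'j : c' j = S.v k p j := by simp only [c', Function.update_of_ne hji]; exact hcj
    refine (S.free_conn J hw0 hc' hw.2 hc'J i (by simp [c']) hwA hwB).trans ?_
    exact S.free_conn J hc' hc hc'J hcJ j (by rw [hcj, hc'j])
      (by rw [hc'j]; exact S.hvA k p j) (by rw [hc'j]; exact S.hvB k p j)
  exact (main q hq).trans (rtg_symm (main q' hq'))

lemma sum_nat_eq_one {f : Fin d → ℕ} (h : ∑ i, f i = 1) :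
    ∃ i, f i = 1 ∧ ∀ s, s ≠ i → f s = 0 := by
  obtain ⟨i, hi⟩ : ∃ i, f i ≠ 0 := by
    by_contra hc
    push Not at hc
    simp [hc] at h
  have h1 := Finset.add_sum_erase Finset.univ f (Finset.mem_univ i)
  have h2 : ∑ x ∈ Finset.univ.erase i, f x = 0 := by omega
  refine ⟨i, by omega, fun s hs => ?_⟩
  exact Finset.sum_eq_zero_iff.mp h2 s (by simp [hs])

lemma adj_update {x y : Pt d} (h : dist1 x y = 1) :
    ∃ i, y = Function.update x i (x i + 1) ∨ x = Function.update y i (y i + 1) := by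
  unfold dist1 at h
  obtain ⟨i, hi, hne⟩ := sum_nat_eq_one h
  have hne' : ∀ s, s ≠ i → x s = y s := by
    intro s hs
    have := hne s hs
    omega
  refine ⟨i, ?_⟩
  have : y i = x i + 1 ∨ x i = y i + 1 := by omega
  rcases this with h | h
  · left; funext s
    by_cases hs : s = i
    · subst hs; simpa using h
    · rw [Function.update_of_ne hs, hne' s hs]
  · right; funext s
    by_cases hs : s = i
    · subst hs; simpa using h
    · rw [Function.update_of_ne hs, hne' s hs]

/-- Lifting connectivity of cells to connectivity of retained vertices. -/
lemma lift_conn (J : Finset (Fin d)) (hJ : 2 ≤ J.card) (x0 : Pt d) (n : ℕ)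
    (hconn : ∀ q : Pt d, ∀ m ∈ S.Ret n q, ∀ m' ∈ S.Ret n q, (∀ t, t ∉ J → m t = x0 t) →
      (∀ t, t ∉ J → m' t = x0 t) →
      Relation.ReflTransGen (stepRelL 1 {z | z ∈ S.Ret n q ∧ ∀ t, t ∉ J → z t = x0 t}) m m')
    (K : Set (Pt d)) (hK : ∀ q ∈ K, ∀ t, t ∉ J → q t = S.idx n x0 t)
    (T : Set (Pt d)) (hT : ∀ q ∈ K, ∀ m ∈ S.Ret n q, (∀ t, t ∉ J → m t = x0 t) → m ∈ T)
    {q q' : Pt d} (hq : q ∈ K) (h : Relation.ReflTransGen (stepRelL 1 K) q q') :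
    ∀ m ∈ S.Ret n q, ∀ m' ∈ S.Ret n q', (∀ t, t ∉ J → m t = x0 t) →
      (∀ t, t ∉ J → m' t = x0 t) → Relation.ReflTransGen (stepRelL 1 T) m m' := by
  have base : ∀ q ∈ K, ∀ m ∈ S.Ret n q, ∀ m' ∈ S.Ret n q, (∀ t, t ∉ J → m t = x0 t) →
      (∀ t, t ∉ J → m' t = x0 t) → Relation.ReflTransGen (stepRelL 1 T) m m' := by
    intro q hq m hm m' hm' h h'
    refine Relation.ReflTransGen.mono ?_ _ _ (hconn q m hm m' hm' h h')
    rintro x y ⟨h1, h2, h3⟩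
    exact ⟨h1, hT q hq x h2.1 h2.2, hT q hq y h3.1 h3.2⟩
  induction h with
  | refl => exact base q hq
  | @tail b c _ hbc ih =>
    intro m hm m' hm' hmJ hm'J
    obtain ⟨hd1, hb, hc⟩ := hbc
    obtain ⟨i, hi⟩ := adj_update hd1
    have hiJ : i ∈ J := by
      by_contra hiJ
      have e1 := hK b hb i hiJ
      have e2 := hK c hc i hiJ
      rcases hi with e | e
      · have := congrFun e i
        simp only [Function.update_self] at this
        omega
      · have := congrFun e i
        simp only [Function.update_self] at this
        omega
    obtain ⟨mb, hmb, mc, hmc, hmbJ, hmcJ, hadj⟩ : ∃ mb ∈ S.Ret n b, ∃ mc ∈ S.Ret n c,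
        (∀ t, t ∉ J → mb t = x0 t) ∧ (∀ t, t ∉ J → mc t = x0 t) ∧ dist1 mb mc = 1 := by
      have aux : ∀ b ∈ K, ∃ m ∈ S.Ret n b, ∃ m' ∈ S.Ret n (Function.update b i (b i + 1)),
          (∀ t, t ∉ J → m t = x0 t) ∧ (∀ t, t ∉ J → m' t = x0 t) ∧ dist1 m m' = 1 := by
        intro b hb
        obtain ⟨m, hm, m', hm', h1, rfl⟩ := S.glue J hJ x0 i hiJ n b (hK b hb)
        refine ⟨m, hm, _, hm', h1, fun t ht => ?_, ?_⟩
        · have hti : t ≠ i := fun e => ht (e ▸ hiJ)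
          rw [Function.update_of_ne hti]; exact h1 t ht
        · rw [dist1_update]; omega
      rcases hi with e | e
      · rw [e]; exact aux b hb
      · obtain ⟨m, hm, m', hm', h1, h2, h3⟩ := aux c hc
        rw [← e] at hm'
        exact ⟨m', hm', m, hm, h2, h1, by rw [dist1_comm']; exact h3⟩
    exact ((ih m hm mb hmb hmJ hmbJ).tail
      ⟨hadj, hT b hb mb hmb hmbJ, hT c hc mc hmc hmcJ⟩).trans
      (base c hc mc hmc m' hm' hmcJ hm'J)

lemma Ret_conn (J : Finset (Fin d)) (hJ : 2 ≤ J.card) (x0 : Pt d) : ∀ n : ℕ, ∀ q : Pt d,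
    ∀ m ∈ S.Ret n q, ∀ m' ∈ S.Ret n q, (∀ t, t ∉ J → m t = x0 t) →
      (∀ t, t ∉ J → m' t = x0 t) →
      Relation.ReflTransGen (stepRelL 1 {z | z ∈ S.Ret n q ∧ ∀ t, t ∉ J → z t = x0 t}) m m' := by
  intro n
  induction n with
  | zero =>
    intro q m hm m' hm' _ _
    simp only [Ret, Finset.mem_singleton] at hm hm'
    subst hm; subst hm'; exact Relation.ReflTransGen.refl
  | succ n ih =>
    intro p m hm m' hm' hmJ hm'J
    simp only [Ret, Finset.mem_biUnion] at hm hm'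
    obtain ⟨q, hq, hm⟩ := hm
    obtain ⟨q', hq', hm'⟩ := hm'
    have hqJ : q ∈ S.KJ J n p (S.idx n x0) := by
      refine ⟨hq, fun t ht => ?_⟩
      rw [← S.idx_of_Ret hm]; simp only [idx, hmJ t ht]
    have hqJ' : q' ∈ S.KJ J n p (S.idx n x0) := by
      refine ⟨hq', fun t ht => ?_⟩
      rw [← S.idx_of_Ret hm']; simp only [idx, hm'J t ht]
    refine S.lift_conn J hJ x0 n ih (S.KJ J n p (S.idx n x0)) (fun q hq => hq.2) _ ?_ hqJ
      (S.cell_conn J hJ hqJ hqJ') m hm m' hm' hmJ hm'J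
    intro q hq m hm hmJ
    refine ⟨?_, hmJ⟩
    simp only [Ret, Finset.mem_biUnion]
    exact ⟨q, hq.1, hm⟩

/-- Slice of a product finset. -/
def slc (J : Finset (Fin d)) (y : Pt d) (X : Fin d → Finset ℤ) : Finset (Pt d) :=
  Fintype.piFinset fun i => if i ∈ J then X i else {y i}

lemma card_slc (J : Finset (Fin d)) (y : Pt d) (X : Fin d → Finset ℤ) :
    (slc J y X).card = ∏ i ∈ J, (X i).card := by
  rw [slc, Fintype.card_piFinset, ← Finset.prod_subset (Finset.subset_univ J)]
  · exact Finset.prod_congr rfl fun i hi => by simp [hi]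
  · intro i _ hi; simp [hi]

lemma mem_slc {J : Finset (Fin d)} {y : Pt d} {X : Fin d → Finset ℤ} {q : Pt d} :
    q ∈ slc J y X ↔ (∀ i ∈ J, q i ∈ X i) ∧ ∀ i, i ∉ J → q i = y i := by
  simp only [slc, Fintype.mem_piFinset]
  constructor
  · intro h
    exact ⟨fun i hi => by simpa [hi] using h i, fun i hi => by simpa [hi] using h i⟩
  · rintro ⟨h1, h2⟩ i
    by_cases hi : i ∈ J
    · simpa [hi] using h1 i hi
    · simpa [hi] using h2 i hi

lemma card_KJ (J : Finset (Fin d)) (k : ℕ) (p y : Pt d) (hy : ∀ t, t ∉ J → y t / S.l k = p t) :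
    S.l k ^ J.card - 3 * S.r k ^ J.card ≤
      ((S.K k p).filter fun q => ∀ t, t ∉ J → q t = y t).card := by
  have hC : ∀ i, (S.C k p i).card ≤ S.r k := by
    intro i
    rcases S.hC k p i with e | e <;> rw [e]
    · exact S.cA k p i
    · exact S.cB k p i
  have hcard : ∀ X : Fin d → Finset ℤ, (∀ i, (X i).card ≤ S.r k) →
      (slc J y X).card ≤ S.r k ^ J.card := by
    intro X hX
    rw [card_slc]
    exact Finset.prod_le_pow_card _ _ _ fun i _ => hX i
  let W := slc J y fun i => Finset.Ico ((S.l k : ℤ) * p i) (S.l k * p i + S.l k)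
  have hW : W.card = S.l k ^ J.card := by
    rw [card_slc]; simp
  have hsub : W \ ((slc J y (S.A k p) ∪ slc J y (S.B k p)) ∪ slc J y (S.C k p)) ⊆
      ((S.K k p).filter fun q => ∀ t, t ∉ J → q t = y t) := by
    intro q hq
    simp only [W, Finset.mem_sdiff, Finset.mem_union, mem_slc, not_or, mem_Ico_iff] at hq
    obtain ⟨⟨h1, h2⟩, ⟨h3, h4⟩, h5⟩ := hq
    rw [Finset.mem_filter, mem_K]
    refine ⟨⟨fun i => ?_, fun h => h3 ⟨fun i _ => h i, h2⟩, fun h => h4 ⟨fun i _ => h i, h2⟩,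
      fun h => h5 ⟨fun i _ => h i, h2⟩⟩, h2⟩
    by_cases hi : i ∈ J
    · exact h1 i hi
    · rw [h2 i hi]; exact hy i hi
  refine le_trans ?_ (Finset.card_le_card hsub)
  have h0 := Finset.le_card_sdiff ((slc J y (S.A k p) ∪ slc J y (S.B k p)) ∪ slc J y (S.C k p)) W
  have h1 := Finset.card_union_le (slc J y (S.A k p) ∪ slc J y (S.B k p)) (slc J y (S.C k p))
  have h2 := Finset.card_union_le (slc J y (S.A k p)) (slc J y (S.B k p))
  have h3 := hcard _ (S.cA k p)
  have h4 := hcard _ (S.cB k p)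
  have h5 := hcard _ hC
  rw [hW] at h0
  omega

/-- Retained vertices of a slice inside a family of cells: counting. -/
lemma card_biUnion_slice (J : Finset (Fin d)) (x0 : Pt d) (n N : ℕ) (F : Finset (Pt d))
    (h : ∀ q ∈ F, N ≤ ((S.Ret n q).filter fun m => ∀ t, t ∉ J → m t = x0 t).card) :
    F.card * N ≤ ((F.biUnion (S.Ret n)).filter fun m => ∀ t, t ∉ J → m t = x0 t).card := by
  rw [Finset.filter_biUnion, Finset.card_biUnion]
  · rw [← smul_eq_mul]
    exact Finset.card_nsmul_le_sum _ _ _ h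
  · intro q _ q' _ hne
    rw [Function.onFun, Finset.disjoint_left]
    intro m hm hm'
    exact hne ((S.idx_of_Ret (Finset.mem_filter.mp hm).1).symm.trans
      (S.idx_of_Ret (Finset.mem_filter.mp hm').1))

lemma count (J : Finset (Fin d)) (x0 : Pt d) : ∀ n : ℕ, ∀ p : Pt d,
    (∀ t, t ∉ J → p t = S.idx n x0 t) →
    ∏ i ∈ Finset.range n, (S.l i ^ J.card - 3 * S.r i ^ J.card) ≤
      ((S.Ret n p).filter fun m => ∀ t, t ∉ J → m t = x0 t).card := by
  intro n
  induction n with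
  | zero =>
    intro p hp
    have : p ∈ ((S.Ret 0 p).filter fun m => ∀ t, t ∉ J → m t = x0 t) := by
      rw [Finset.mem_filter]
      refine ⟨by simp [Ret], fun t ht => ?_⟩
      rw [hp t ht, idx_zero]
    simpa using Finset.card_pos.mpr ⟨p, this⟩
  | succ n ih =>
    intro p hp
    rw [Finset.prod_range_succ, mul_comm]
    have h1 := S.card_KJ J n p (S.idx n x0) (fun t ht => by rw [hp t ht, idx_succ])
    refine (Nat.mul_le_mul_right _ h1).trans ?_
    refine (S.card_biUnion_slice J x0 n _ _ ?_).trans (Finset.card_le_card ?_)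
    · intro q hq
      exact ih q (Finset.mem_filter.mp hq).2
    · simp only [Ret]
      exact Finset.filter_subset_filter _ (Finset.biUnion_subset_biUnion_of_subset_left _ (Finset.filter_subset _ _))

/-- The final set in a cuboid of level-`n` cells. -/
def fin (J : Finset (Fin d)) (x0 : Pt d) (n : ℕ) (lo : Pt d) (N : ℕ) : Set (Pt d) :=
  {m | (∀ i, lo i ≤ S.idx n m i ∧ S.idx n m i < lo i + N) ∧ m ∈ S.Ret n (S.idx n m) ∧
    ∀ t, t ∉ J → m t = x0 t}

lemma fin_conn (J : Finset (Fin d)) (hJ : 2 ≤ J.card) (x0 : Pt d) (n : ℕ) (lo : Pt d) (N : ℕ)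
    {m m' : Pt d} (hm : m ∈ S.fin J x0 n lo N) (hm' : m' ∈ S.fin J x0 n lo N) :
    Relation.ReflTransGen (stepRelL 1 (S.fin J x0 n lo N)) m m' := by
  let K : Set (Pt d) := {q | (∀ i, lo i ≤ q i ∧ q i < lo i + N) ∧ ∀ t, t ∉ J → q t = S.idx n x0 t}
  have hmem : ∀ m ∈ S.fin J x0 n lo N, S.idx n m ∈ K := by
    intro m hm
    exact ⟨hm.1, fun t ht => by simp only [idx, hm.2.2 t ht]⟩
  refine S.lift_conn J hJ x0 n (S.Ret_conn J hJ x0 n) K (fun q hq => hq.2) _ ?_ (hmem m hm)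
    (cuboid_conn K _ _ _ rfl ?_) m hm.2.1 m' hm'.2.1 hm.2.2 hm'.2.2
  · intro q hq z hz hzJ
    have e := S.idx_of_Ret hz
    exact ⟨by rw [e]; exact hq.1, by rw [e]; exact hz, hzJ⟩
  · intro z hz
    rw [mem_uIcc_pi] at hz
    have h1 := hmem m hm
    have h2 := hmem m' hm'
    refine ⟨fun i => ?_, fun t ht => ?_⟩
    · have a1 := h1.1 i
      have a2 := h2.1 i
      have a3 := hz i
      rw [Set.mem_uIcc] at a3
      omega
    · have := hz t
      rw [h1.2 t ht, h2.2 t ht] at this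
      simpa using this

lemma fin_count (J : Finset (Fin d)) (x0 : Pt d) (n : ℕ) (lo : Pt d) (N : ℕ)
    (hx0 : ∀ i, lo i ≤ S.idx n x0 i ∧ S.idx n x0 i < lo i + N) :
    N ^ J.card * ∏ i ∈ Finset.range n, (S.l i ^ J.card - 3 * S.r i ^ J.card) ≤
      (S.fin J x0 n lo N).ncard := by
  let F := slc J (S.idx n x0) fun i => Finset.Ico (lo i) (lo i + N)
  have hF : F.card = N ^ J.card := by rw [card_slc]; simp
  have := S.card_biUnion_slice J x0 n _ F
    (fun q hq => S.count J x0 n q (mem_slc.mp hq).2)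
  rw [hF] at this
  refine this.trans (le_of_eq ?_)
  rw [← Set.ncard_coe_finset]
  congr 1
  ext m
  simp only [Finset.coe_filter, Finset.mem_biUnion, Set.mem_ofPred_eq, fin]
  constructor
  · rintro ⟨⟨q, hq, hm⟩, hmJ⟩
    have e := S.idx_of_Ret hm
    rw [e]
    refine ⟨fun i => ?_, hm, hmJ⟩
    obtain ⟨h1, h2⟩ := mem_slc.mp hq
    by_cases hi : i ∈ J
    · simpa using h1 i hi
    · rw [h2 i hi]; exact hx0 i
  · rintro ⟨h1, h2, h3⟩
    refine ⟨⟨_, mem_slc.mpr ⟨fun i _ => by simpa using h1 i, fun i hi => ?_⟩, h2⟩, h3⟩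
    simp only [idx, h3 i hi]

end Scheme

/-! ### Transfer to the lattice -/

lemma exists_scheme (l r : ℕ → ℕ) (hl : ∀ k, 4 * r k < l k) (bad : ℕ → Pt d → Prop)
    (h : ∀ k p, ¬ bad (k+1) p → ∃ a b : Pt d, ∀ q : Pt d, (∀ i, q i / l k = p i) → bad k q →
      (∀ i, q i ∈ Finset.Ico (a i) (a i + r k)) ∨ (∀ i, q i ∈ Finset.Ico (b i) (b i + r k))) :
    ∃ S : Scheme d, S.l = l ∧ S.r = r ∧ S.bad = bad := by
  have h' : ∀ k p, ∃ a b : Pt d, ¬ bad (k+1) p → ∀ q : Pt d, (∀ i, q i / l k = p i) → bad k q →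
      (∀ i, q i ∈ Finset.Ico (a i) (a i + r k)) ∨ (∀ i, q i ∈ Finset.Ico (b i) (b i + r k)) := by
    intro k p
    by_cases hb : bad (k+1) p
    · exact ⟨0, 0, fun h => absurd hb h⟩
    · obtain ⟨a, b, hab⟩ := h k p hb
      exact ⟨a, b, fun _ => hab⟩
  choose a b hab using h'
  have hdata := fun k p i => interval_data (a k p i) (b k p i) (l k * p i) (l k) (r k) (hl k)
  choose v c h1 h2 h3 h4 h5 h6 using hdata
  refine ⟨{ l := l, r := r, hl := hl, bad := bad,
            A := fun k p i => Finset.Ico (a k p i) (a k p i + r k),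
            B := fun k p i => Finset.Ico (b k p i) (b k p i + r k),
            C := fun k p i => Finset.Ico (c k p i) (c k p i + r k),
            v := v, cA := ?_, cB := ?_, hC := ?_, hv := ?_, hvA := h3, hvB := h4, hdir := h6,
            hbad := hab }, rfl, rfl, rfl⟩
  · intro k p i; simp
  · intro k p i; simp
  · intro k p i
    rcases h5 k p i with e | e <;> rw [e]
    · exact Or.inl rfl
    · exact Or.inr rfl
  · intro k p i
    have hp : (0 : ℤ) < l k := by have := hl k; omega
    rw [Int.ediv_eq_iff_of_pos hp]
    have e1 := h1 k p i
    have e2 := h2 k p i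
    constructor <;> nlinarith

lemma natAbs_le_distInf (x y : Pt d) (i : Fin d) : (x i - y i).natAbs ≤ distInf x y :=
  Finset.le_sup (f := fun i => (x i - y i).natAbs) (Finset.mem_univ i)

lemma mem_ballZ_zero {y : Pt d} {R : ℕ} : y ∈ ballZ (0 : Pt d) R ↔ ∀ i, -(R : ℤ) ≤ y i ∧ y i ≤ R := by
  simp only [ballZ, distInf, Set.mem_ofPred_eq, Finset.sup_le_iff, Finset.mem_univ, true_imp_iff,
    Pi.zero_apply]
  exact forall_congr' fun i => by omega

lemma distInf_lt {x y : Pt d} {N i} (h : distInf x y < N) : (x i - y i).natAbs < N :=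
  (natAbs_le_distInf x y i).trans_lt h

lemma LSc_pos (l0 L0 θ : ℕ) (hl0 : 0 < l0) (hL0 : 0 < L0) : ∀ k, 0 < LSc l0 L0 θ k
  | 0 => hL0
  | k+1 => by
      simp only [LSc, lSc]
      have := LSc_pos l0 L0 θ hl0 hL0 k
      positivity

lemma cascade_cover (r0 l0 L0 θ : ℕ) (hl0 : 0 < l0) (hr0 : 0 < r0) (hL0 : 0 < L0)
    (seed : Pt d → Set (Config d)) (ω : Config d)
    (k : ℕ) (p : Pt d)
    (h : ω ∉ cascade d r0 l0 L0 θ seed (k+1) (fun i => (LSc l0 L0 θ (k+1) : ℤ) * p i)) :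
    ∃ a : Pt d, ∀ q : Pt d, (∀ i, q i / (lSc l0 θ k : ℤ) = p i) →
      ω ∈ cascade d r0 l0 L0 θ seed k (fun i => (LSc l0 L0 θ k : ℤ) * q i) →
      ∀ i, q i ∈ Finset.Ico (a i) (a i + rSc r0 θ k) := by
  have hL : (0 : ℤ) < LSc l0 L0 θ k := by exact_mod_cast LSc_pos l0 L0 θ hl0 hL0 k
  have hl : (0 : ℤ) < lSc l0 θ k := by
    have : 0 < lSc l0 θ k := by unfold lSc; positivity
    exact_mod_cast this
  let Q : Set (Pt d) := {q | (∀ i, q i / (lSc l0 θ k : ℤ) = p i) ∧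
    ω ∈ cascade d r0 l0 L0 θ seed k (fun i => (LSc l0 L0 θ k : ℤ) * q i)}
  have hbox : ∀ q : Pt d, (∀ i, q i / (lSc l0 θ k : ℤ) = p i) →
      (fun i => (LSc l0 L0 θ k : ℤ) * q i) ∈ lattice d (LSc l0 L0 θ k) ∩
        box (fun i => (LSc l0 L0 θ (k+1) : ℤ) * p i) (LSc l0 L0 θ (k+1)) := by
    intro q hq
    refine ⟨fun i => dvd_mul_right _ _, fun i => ?_⟩
    have := hq i
    rw [Int.ediv_eq_iff_of_pos hl] at this
    simp only [LSc]
    push_cast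
    constructor <;> nlinarith
  have hpair : ∀ q ∈ Q, ∀ q' ∈ Q, ∀ i, (q i - q' i).natAbs < rSc r0 θ k := by
    intro q hq q' hq' i
    by_contra hge
    push Not at hge
    apply h
    refine ⟨_, _, hbox q hq.1, hbox q' hq'.1, ?_, hq.2, hq'.2⟩
    refine le_trans ?_ (natAbs_le_distInf _ _ i)
    rw [← mul_sub, Int.natAbs_mul, Int.natAbs_natCast, mul_comm]
    exact Nat.mul_le_mul_left _ hge
  by_cases hne : Q.Nonempty
  · obtain ⟨q0, hq0⟩ := hne
    have hmin : ∀ i, ∃ t : ℤ, (∃ q ∈ Q, q i = t) ∧ ∀ q ∈ Q, t ≤ q i := by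
      intro i
      obtain ⟨t, ht1, ht2⟩ := Int.exists_least_of_bdd (P := fun t => ∃ q ∈ Q, q i = t)
        ⟨q0 i - rSc r0 θ k, by
          rintro z ⟨q, hq, rfl⟩
          have := hpair q hq q0 hq0 i
          omega⟩ ⟨q0 i, q0, hq0, rfl⟩
      exact ⟨t, ht1, fun q hq => ht2 _ ⟨q, hq, rfl⟩⟩
    choose a ha1 ha2 using hmin
    refine ⟨a, fun q hq1 hq2 i => ?_⟩
    obtain ⟨q', hq', e⟩ := ha1 i
    have e1 := ha2 i q ⟨hq1, hq2⟩
    have e2 := hpair q ⟨hq1, hq2⟩ q' hq' i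
    rw [Finset.mem_Ico]
    omega
  · exact ⟨0, fun q h1 h2 => absurd ⟨q, h1, h2⟩ hne⟩

lemma LSc_eq (S : Scheme d) (l0 L0 θ : ℕ) (h : S.l = lSc l0 θ) : ∀ k, LSc l0 L0 θ k = L0 * S.D k
  | 0 => by simp [LSc, S.D_zero]
  | k+1 => by rw [LSc, LSc_eq S l0 L0 θ h k, S.D_succ, h]; ring

lemma LSc_dvd (l0 L0 θ : ℕ) {n s : ℕ} (h : n ≤ s) : LSc l0 L0 θ n ∣ LSc l0 L0 θ s := by
  induction s, h using Nat.le_induction with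
  | base => exact dvd_rfl
  | succ s _ ih => exact ih.trans (by rw [LSc]; exact dvd_mul_left _ _)

/-- Slices are coordinate slices. -/
lemma slice_coord {j : ℕ} (e : Fin j → Pt d) (he : orthoUnit e) :
    ∃ J : Finset (Fin d), J.card = j ∧ ∀ x0 y : Pt d, y ∈ sliceSpan x0 e ↔
      ∀ t, t ∉ J → y t = x0 t := by
  obtain ⟨h1, h2⟩ := he
  have h3 : ∀ i, ∃ t, (e i t).natAbs = 1 ∧ ∀ s, s ≠ t → e i s = 0 := by
    intro i
    have := h1 i
    unfold dist1 at this
    obtain ⟨t, ht, hs⟩ := Scheme.sum_nat_eq_one this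
    refine ⟨t, by simpa using ht, fun s hst => by simpa using hs s hst⟩
  choose t ht hs using h3
  have hsq : ∀ i, e i (t i) * e i (t i) = 1 := by
    intro i
    rcases Int.natAbs_eq (e i (t i)) with h | h <;> rw [ht i] at h <;> rw [h] <;> norm_num
  have hinj : Function.Injective t := by
    intro i i' hii
    by_contra hne
    have h0 := h2 hne
    simp only at h0
    rw [Finset.sum_eq_single (t i)] at h0
    · rcases mul_eq_zero.mp h0 with h | h
      · have := ht i; rw [h] at this; simp at this
      · rw [hii] at h; have := ht i'; rw [h] at this; simp at this
    · intro s _ hst; rw [hs i s hst, zero_mul]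
    · simp
  refine ⟨Finset.univ.image t, by rw [Finset.card_image_of_injective _ hinj]; simp, ?_⟩
  intro x0 y
  constructor
  · rintro ⟨c, rfl⟩ s hsJ
    have : ∀ i, e i s = 0 := by
      intro i
      apply hs
      rintro rfl
      exact hsJ (Finset.mem_image_of_mem _ (Finset.mem_univ i))
    simp [Finset.sum_apply, this]
  · intro h
    refine ⟨fun i => (y (t i) - x0 (t i)) * e i (t i), ?_⟩
    funext s
    simp only [Pi.add_apply, Finset.sum_apply, Pi.smul_apply, smul_eq_mul]
    by_cases hsJ : s ∈ Finset.univ.image t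
    · obtain ⟨i, -, rfl⟩ := Finset.mem_image.mp hsJ
      rw [Finset.sum_eq_single i]
      · rw [mul_assoc, hsq]; ring
      · intro i' _ hne
        rw [hs i' (t i) (fun e => hne (hinj e).symm), mul_zero]
      · simp
    · rw [h s hsJ, Finset.sum_eq_zero, add_zero]
      intro i _
      rw [hs i s (fun e => hsJ (e ▸ Finset.mem_image_of_mem _ (Finset.mem_univ i))), mul_zero]

lemma region (S : Scheme d) (L0 n : ℕ) (hL0 : 0 < L0) (ρ : ℕ) (G : Set (Pt d))
    (hG : ∀ z, z ∈ G ↔ z ∈ lattice d L0 ∩ ballZ 0 ρ ∧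
      (fun i => z i / (L0 : ℤ)) ∈ S.Ret n (S.idx n fun i => z i / (L0 : ℤ)))
    (lo : Pt d) (N : ℕ) (bx : Set (Pt d))
    (hbx : ∀ z, z ∈ bx ↔ ∀ i, ((L0 * S.D n : ℕ) : ℤ) * lo i ≤ z i ∧
      z i < ((L0 * S.D n : ℕ) : ℤ) * (lo i + N))
    (hsub : bx ⊆ ballZ 0 ρ) (x0 : Pt d) (hx0 : x0 ∈ lattice d L0 ∩ bx)
    (J : Finset (Fin d)) (hJ : 2 ≤ J.card) (Sl : Set (Pt d))
    (hSl : ∀ y, y ∈ Sl ↔ ∀ t, t ∉ J → y t = x0 t) :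
    IsConnL L0 (G ∩ bx ∩ Sl) ∧
      N ^ J.card * ∏ i ∈ Finset.range n, (S.l i ^ J.card - 3 * S.r i ^ J.card) ≤
        (G ∩ bx ∩ Sl).ncard := by
  have hL : (0 : ℤ) < L0 := by exact_mod_cast hL0
  have hD : (0 : ℤ) < S.D n := by
    have : 0 < S.D n := Finset.prod_pos fun i _ => by have := S.hl i; omega
    exact_mod_cast this
  let y0 : Pt d := fun i => x0 i / (L0 : ℤ)
  have hy0 : ∀ i, x0 i = L0 * y0 i := fun i => (Int.mul_ediv_cancel' (hx0.1 i)).symm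
  let φ : Pt d → Pt d := fun m i => (L0 : ℤ) * m i
  have hφdiv : ∀ m : Pt d, (fun i => φ m i / (L0 : ℤ)) = m := by
    intro m; funext i; exact Int.mul_ediv_cancel_left _ hL.ne'
  have hφinj : Function.Injective φ := by
    intro m m' h
    rw [← hφdiv m, ← hφdiv m', h]
  have hcell : ∀ m : Pt d, φ m ∈ bx ↔ ∀ i, lo i ≤ S.idx n m i ∧ S.idx n m i < lo i + N := by
    intro m
    rw [hbx]
    refine forall_congr' fun i => ?_
    simp only [φ, Scheme.idx]
    rw [Int.le_ediv_iff_mul_le hD, Int.ediv_lt_iff_lt_mul hD]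
    push_cast
    rw [mul_assoc, mul_assoc, mul_le_mul_iff_right₀ hL, mul_lt_mul_iff_right₀ hL, mul_comm (lo i),
      mul_comm (lo i + _)]
  have hmem : ∀ m : Pt d, φ m ∈ G ∩ bx ∩ Sl ↔ m ∈ S.fin J y0 n lo N := by
    intro m
    have e1 : φ m ∈ lattice d L0 := fun i => dvd_mul_right _ _
    have e2 : φ m ∈ Sl ↔ ∀ t, t ∉ J → m t = y0 t := by
      rw [hSl]
      refine forall_congr' fun t => imp_congr_right fun _ => ?_
      rw [hy0 t]
      exact mul_right_inj' hL.ne'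
    have e3 := hG (φ m)
    rw [hφdiv] at e3
    simp only [Set.mem_inter_iff, e2, hcell, e3, Scheme.fin, Set.mem_ofPred_eq]
    constructor
    · rintro ⟨⟨⟨_, h2⟩, h3⟩, h4⟩; exact ⟨h3, h2, h4⟩
    · rintro ⟨h3, h2, h4⟩; exact ⟨⟨⟨⟨e1, hsub ((hcell m).mpr h3)⟩, h2⟩, h3⟩, h4⟩
  have himg : G ∩ bx ∩ Sl = φ '' S.fin J y0 n lo N := by
    ext z
    constructor
    · intro hz
      have hzl : z ∈ lattice d L0 := ((hG z).mp hz.1.1).1.1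
      have : φ (fun i => z i / (L0 : ℤ)) = z := by
        funext i; exact Int.mul_ediv_cancel' (hzl i)
      refine ⟨_, ?_, this⟩
      rw [← hmem, this]; exact hz
    · rintro ⟨m, hm, rfl⟩
      exact (hmem m).mpr hm
  constructor
  · intro x hx y hy
    refine ⟨hx, hy, ?_⟩
    rw [himg] at hx hy ⊢
    obtain ⟨m, hm, rfl⟩ := hx
    obtain ⟨m', hm', rfl⟩ := hy
    refine Relation.ReflTransGen.lift φ ?_ _ _ (S.fin_conn J hJ y0 n lo N hm hm')
    rintro a b ⟨h1, h2, h3⟩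
    refine ⟨?_, Set.mem_image_of_mem _ h2, Set.mem_image_of_mem _ h3⟩
    unfold dist1 at h1 ⊢
    simp only [φ]
    simp_rw [← mul_sub, Int.natAbs_mul, Int.natAbs_natCast]
    rw [← Finset.mul_sum, h1, mul_one]
  · rw [himg, Set.ncard_image_of_injective _ hφinj]
    exact S.fin_count J y0 n lo N (fun i => (hcell y0).mp (by
      have : φ y0 = x0 := by funext i; exact (hy0 i).symm
      rw [this]; exact hx0.2) i)

lemma ratio_le (r0 l0 θ i : ℕ) (h : 4 * r0 < l0) (hθ : 1 ≤ θ) :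
    ((rSc r0 θ i : ℝ) / (lSc l0 θ i)) ≤ (1/4) * (1/2) ^ i := by
  have hl : (0 : ℝ) < l0 := by exact_mod_cast (show 0 < l0 by omega)
  have h' : (4 : ℝ) * r0 ≤ l0 := by exact_mod_cast h.le
  unfold rSc lSc
  push_cast
  have h1 : (2 : ℝ) ^ i ≤ 2 ^ (i ^ θ) := by
    apply pow_le_pow_right₀ (by norm_num)
    rcases Nat.eq_zero_or_pos i with rfl | hi
    · exact Nat.zero_le _
    · exact Nat.le_self_pow (by omega) i
  have h4 : (4 : ℝ) ^ (i ^ θ) = 2 ^ (i ^ θ) * 2 ^ (i ^ θ) := by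
    rw [← mul_pow]; norm_num
  rw [div_le_iff₀ (by positivity), h4]
  set E : ℝ := 2 ^ (i ^ θ) with hE
  have hEp : 0 < E := by positivity
  have h5 : (1 : ℝ) ≤ (1/2) ^ i * E := by
    rw [one_div, inv_pow, inv_mul_eq_div, le_div_iff₀ (by positivity)]; linarith
  calc (r0 : ℝ) * E ≤ (1/4 * l0) * E := by nlinarith
    _ ≤ (1/4 * l0) * E * ((1/2) ^ i * E) := le_mul_of_one_le_right (by positivity) h5
    _ = _ := by ring

lemma fj_le (r0 l0 θ j n : ℕ) (h : 4 * r0 < l0) (hθ : 1 ≤ θ) (hj : 1 ≤ j) :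
    fjProd r0 l0 θ j ≤ ∏ i ∈ Finset.range n, (1 - 3 * ((rSc r0 θ i : ℝ) / (lSc l0 θ i)) ^ j) := by
  set ρ : ℕ → ℝ := fun i => (rSc r0 θ i : ℝ) / (lSc l0 θ i) with hρ
  have h0 : ∀ i, 0 ≤ ρ i := fun i => by positivity
  have h1 : ∀ i, ρ i ≤ (1/4) * (1/2) ^ i := fun i => ratio_le r0 l0 θ i h hθ
  have h1' : ∀ i, ρ i ≤ 1/4 := fun i => (h1 i).trans (by
    have : ((1:ℝ)/2) ^ i ≤ 1 := pow_le_one₀ (by norm_num) (by norm_num)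
    linarith)
  have h2 : ∀ i, ρ i ^ j ≤ ρ i := fun i =>
    pow_le_of_le_one (h0 i) (by linarith [h1' i]) (by omega)
  have hsum : Summable fun i => -(3 * ρ i ^ j) := by
    apply Summable.neg
    apply Summable.mul_left
    refine Summable.of_nonneg_of_le (fun i => pow_nonneg (h0 i) j)
      (fun i => (h2 i).trans (h1 i)) ?_
    exact Summable.mul_left _ (summable_geometric_of_lt_one (by norm_num) (by norm_num))
  have hm : Multipliable fun i => 1 - 3 * ρ i ^ j := by
    simpa only [sub_eq_add_neg] using Real.multipliable_one_add_of_summable hsum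
  have ht := hm.hasProd.tendsto_prod_nat
  refine le_of_tendsto ht ?_
  filter_upwards [eventually_ge_atTop n] with m hmn
  have hf0 : ∀ i, 0 ≤ 1 - 3 * ρ i ^ j := fun i => by linarith [h2 i, h1' i]
  have hf1 : ∀ i, 1 - 3 * ρ i ^ j ≤ 1 := fun i => by linarith [pow_nonneg (h0 i) j]
  exact Finset.prod_le_prod_of_subset_of_le_one (Finset.range_mono hmn) (fun i _ => hf0 i)
    (fun i _ _ => hf1 i)

lemma count_real (S : Scheme d) (r0 l0 θ j n N : ℕ) (h : 4 * r0 < l0) (hθ : 1 ≤ θ) (hj : 1 ≤ j)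
    (hl : S.l = lSc l0 θ) (hr : S.r = rSc r0 θ) :
    ((N : ℝ) * S.D n) ^ j * fjProd r0 l0 θ j ≤
      ((N ^ j * ∏ i ∈ Finset.range n, (S.l i ^ j - 3 * S.r i ^ j) : ℕ) : ℝ) := by
  refine (mul_le_mul_of_nonneg_left (fj_le r0 l0 θ j n h hθ hj) (by positivity)).trans (le_of_eq ?_)
  push_cast
  rw [mul_pow, mul_assoc]
  congr 1
  unfold Scheme.D
  push_cast
  rw [← Finset.prod_pow, ← Finset.prod_mul_distrib]
  refine Finset.prod_congr rfl fun i _ => ?_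
  have hlt := S.hl i
  have hle : 3 * S.r i ^ j ≤ S.l i ^ j := by
    calc 3 * S.r i ^ j ≤ 4 ^ j * S.r i ^ j := by
          apply Nat.mul_le_mul_right
          have : 4 ^ 1 ≤ 4 ^ j := Nat.pow_le_pow_right (by norm_num) hj
          omega
      _ = (4 * S.r i) ^ j := by rw [mul_pow]
      _ ≤ _ := Nat.pow_le_pow_left hlt.le j
  rw [Nat.cast_sub hle, ← hl, ← hr]
  push_cast
  have hp : (S.l i : ℝ) ≠ 0 := by
    have : 0 < S.l i := by omega
    positivity
  rw [div_pow]
  field_simp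

/-- Proposition 3.1, construction of `𝐆`. Under P1–P3 and S1–S2, with
`4r_0 < l_0` and `R ≥ L_0^{3d²/θ_iso}`, for every configuration in `H` there is a set
`𝐆 ⊆ G_0 ∩ B(0,2R−L_s)` of `0`-good vertices whose restrictions to `L_s`-boxes, and all of whose
`j`-dimensional slices of `3L_s`-boxes, are connected and of the stated density. -/
theorem stmt5 (d : ℕ) (hd : 2 ≤ d) (a b : ℝ) (ha : 0 ≤ a) (hab : a < b)
    (P : ℝ → Measure (Config d)) (Ax : Axioms d a b P)
    (u : ℝ) (hu : u ∈ Set.Ioo a b)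
    (θiso : ℝ) (hθiso : θiso ∈ Set.Ioo (0:ℝ) 1)
    (l0 r0 L0 : ℕ) (hr0 : 0 < r0) (hl0 : 4*r0 < l0) (hL0 : 0 < L0)
    (R : ℕ) (hR : (L0 : ℝ) ^ ((3*(d:ℝ)^2)/θiso) ≤ (R : ℝ))
    (s r : ℕ) (hs : isScaleS d l0 L0 ⌈1/Ax.εP⌉₊ θiso R s) (hr : r = s/2)
    (ω : Config d)
    (hω : ω ∈ eventH d (eta d (P u)) r0 l0 L0 ⌈1/Ax.εP⌉₊ s r R) :
    ∃ G : Set (Pt d),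
      G ⊆ lattice d L0 ∩ ballZ (0 : Pt d) (2*R - LSc l0 L0 ⌈1/Ax.εP⌉₊ s) ∧
      -- (a) every vertex of 𝐆 is 0-good
      (∀ z ∈ G, ω ∈ eventA d (eta d (P u)) L0 z ∧ ω ∈ eventB d (eta d (P u)) L0 z) ∧
      -- (b) density and connectivity in L_s-boxes
      (∀ xs ∈ lattice d (LSc l0 L0 ⌈1/Ax.εP⌉₊ s) ∩
          ballZ (0 : Pt d) (2*R - 2*LSc l0 L0 ⌈1/Ax.εP⌉₊ s),
        IsConnL L0 (G ∩ box xs (LSc l0 L0 ⌈1/Ax.εP⌉₊ s)) ∧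
        ((LSc l0 L0 ⌈1/Ax.εP⌉₊ s : ℝ)/(L0 : ℝ)) ^ d * fjProd r0 l0 ⌈1/Ax.εP⌉₊ d ≤
          (G ∩ box xs (LSc l0 L0 ⌈1/Ax.εP⌉₊ s)).ncard) ∧
      -- (c) density and connectivity of j-dimensional slices of 3L_s-boxes
      (∀ xs ∈ lattice d (LSc l0 L0 ⌈1/Ax.εP⌉₊ s) ∩
          ballZ (0 : Pt d) (2*R - 3*LSc l0 L0 ⌈1/Ax.εP⌉₊ s),
        ∀ x0 ∈ lattice d L0 ∩
          boxI xs (-(LSc l0 L0 ⌈1/Ax.εP⌉₊ s : ℤ)) (2*(LSc l0 L0 ⌈1/Ax.εP⌉₊ s)),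
        ∀ j : ℕ, 2 ≤ j → j ≤ d → ∀ e : Fin j → Pt d, orthoUnit e →
          IsConnL L0 (G ∩ boxI xs (-(LSc l0 L0 ⌈1/Ax.εP⌉₊ s : ℤ))
              (2*(LSc l0 L0 ⌈1/Ax.εP⌉₊ s)) ∩ sliceSpan x0 e) ∧
          ((3*(LSc l0 L0 ⌈1/Ax.εP⌉₊ s) : ℝ)/(L0 : ℝ)) ^ j * fjProd r0 l0 ⌈1/Ax.εP⌉₊ j ≤
            (G ∩ boxI xs (-(LSc l0 L0 ⌈1/Ax.εP⌉₊ s : ℤ))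
              (2*(LSc l0 L0 ⌈1/Ax.εP⌉₊ s)) ∩ sliceSpan x0 e).ncard) := by
  set θ := ⌈1/Ax.εP⌉₊ with hθdef
  have hθ : 1 ≤ θ := Nat.one_le_ceil_iff.mpr (by have := Ax.εP_pos; positivity)
  set η := eta d (P u) with hη
  have hl0p : 0 < l0 := by omega
  have hlr : ∀ k, 4 * rSc r0 θ k < lSc l0 θ k := by
    intro k
    unfold rSc lSc
    have h2 : 2 ^ (k ^ θ) ≤ 4 ^ (k ^ θ) := Nat.pow_le_pow_left (by norm_num) _
    have h3 : 0 < 2 ^ (k ^ θ) := by positivity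
    calc 4 * (r0 * 2 ^ (k ^ θ)) = (4 * r0) * 2 ^ (k ^ θ) := by ring
      _ < l0 * 2 ^ (k ^ θ) := Nat.mul_lt_mul_of_pos_right hl0 h3
      _ ≤ l0 * 4 ^ (k ^ θ) := Nat.mul_le_mul_left _ h2
  obtain ⟨S, hSl, hSr, hSb⟩ := exists_scheme (d := d) (lSc l0 θ) (rSc r0 θ) hlr
    (fun k p => ω ∈ kBad d η r0 l0 L0 θ k (fun i => (LSc l0 L0 θ k : ℤ) * p i)) (by
      intro k p hp
      simp only [kBad, Set.mem_union, not_or] at hp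
      obtain ⟨a, ha⟩ := cascade_cover r0 l0 L0 θ hl0p hr0 hL0 _ ω k p hp.1
      obtain ⟨b, hb⟩ := cascade_cover r0 l0 L0 θ hl0p hr0 hL0 _ ω k p hp.2
      refine ⟨a, b, fun q hq hbad => ?_⟩
      rcases hbad with h | h
      · exact Or.inl (ha q hq h)
      · exact Or.inr (hb q hq h))
  have hLeq := LSc_eq S l0 L0 θ hSl
  have hrs : r ≤ s := by omega
  obtain ⟨M, hM⟩ := LSc_dvd l0 L0 θ hrs
  have hLs := LSc_pos l0 L0 θ hl0p hL0 s
  have hLr := LSc_pos l0 L0 θ hl0p hL0 r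
  set Ls := LSc l0 L0 θ s with hLsdef
  have hLrs : LSc l0 L0 θ r ≤ Ls := Nat.le_of_dvd hLs ⟨M, hM⟩
  -- `L_s` is small compared to `R`
  have hLR : Ls ^ 2 ≤ R := by
    have h1 := hs.1
    rw [← hLsdef] at h1
    have hLs1 : (1 : ℝ) ≤ Ls := by exact_mod_cast hLs
    have hR1 : (1 : ℝ) ≤ R := by
      by_contra hlt
      have : R = 0 := by
        by_contra h0
        exact hlt (by exact_mod_cast Nat.one_le_iff_ne_zero.mpr h0)
      rw [this, Nat.cast_zero, Real.zero_rpow hθiso.1.ne'] at h1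
      have : (1 : ℝ) ≤ (Ls : ℝ) ^ (3 * d ^ 2) := one_le_pow₀ hLs1
      linarith
    have h2 : (R : ℝ) ^ θiso ≤ R := by
      calc (R : ℝ) ^ θiso ≤ (R : ℝ) ^ (1 : ℝ) :=
            Real.rpow_le_rpow_of_exponent_le hR1 hθiso.2.le
        _ = R := Real.rpow_one _
    have h3 : (Ls : ℝ) ^ 2 ≤ (Ls : ℝ) ^ (3 * d ^ 2) :=
      pow_le_pow_right₀ hLs1 (by nlinarith)
    exact_mod_cast h3.trans (h1.trans h2)
  have hcase : (Ls = 1 ∧ 1 ≤ R) ∨ 2 * Ls ≤ R := by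
    rcases Nat.lt_or_ge Ls 2 with h | h
    · left
      have : Ls = 1 := by omega
      rw [this] at hLR
      exact ⟨this, by omega⟩
    · right; nlinarith
  have hLeqr := hLeq r
  have hLseq : Ls = L0 * S.D r * M := by rw [← hLeqr]; exact hM
  let G : Set (Pt d) := {z | z ∈ lattice d L0 ∩ ballZ 0 (2 * R - Ls) ∧
      (fun i => z i / (L0 : ℤ)) ∈ S.Ret r (S.idx r fun i => z i / (L0 : ℤ))}
  have hG : ∀ z, z ∈ G ↔ z ∈ lattice d L0 ∩ ballZ 0 (2 * R - Ls) ∧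
      (fun i => z i / (L0 : ℤ)) ∈ S.Ret r (S.idx r fun i => z i / (L0 : ℤ)) := fun z => Iff.rfl
  have hL0R : (L0 : ℝ) ≠ 0 := by positivity
  have hsd : (Ls : ℝ) / L0 = (M : ℝ) * S.D r := by
    rw [hLseq]; push_cast; field_simp
  refine ⟨G, fun z hz => hz.1, ?_, ?_, ?_⟩
  · rintro z ⟨⟨hzl, hzb⟩, hzR⟩
    have hgood : ¬ S.bad r (S.idx r fun i => z i / (L0 : ℤ)) := by
      rw [hSb]
      apply hω.1
      refine ⟨fun i => dvd_mul_right _ _, ?_⟩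
      rw [mem_ballZ_zero] at hzb ⊢
      intro i
      have hb := hzb i
      have e : S.idx r (fun i => z i / (L0 : ℤ)) i = z i / (LSc l0 L0 θ r : ℤ) := by
        simp only [Scheme.idx]
        rw [Int.ediv_ediv_of_nonneg (Int.natCast_nonneg _), hLeqr]
        push_cast; rfl
      rw [e]
      have hLrz : (0 : ℤ) < LSc l0 L0 θ r := by exact_mod_cast hLr
      have h1 := Int.mul_ediv_self_le (x := z i) hLrz.ne'
      have h2 := Int.lt_mul_ediv_self_add (x := z i) hLrz
      omega
    have h0 := S.good_of_Ret hgood hzR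
    rw [hSb] at h0
    have hz : (fun i => (LSc l0 L0 θ 0 : ℤ) * (z i / (L0 : ℤ))) = z := by
      funext i; exact Int.mul_ediv_cancel' (hzl i)
    simp only [hz] at h0
    simp only [kBad, Abar, Bbar, cascade, Set.mem_union, Set.mem_compl_iff, not_or, not_not] at h0
    exact h0
  · rintro xs ⟨hxl, hxb⟩
    choose w hw using hxl
    have hreg := region S L0 r hL0 (2 * R - Ls) G hG (fun i => M * w i) M (box xs Ls) (by
        intro z
        refine forall_congr' fun i => ?_
        have e1 : ((L0 * S.D r : ℕ) : ℤ) * (M * w i) = xs i := by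
          rw [hw i, hLseq]; push_cast; ring
        have e2 : ((L0 * S.D r : ℕ) : ℤ) * (M * w i + M) = xs i + Ls := by
          rw [hw i, hLseq]; push_cast; ring
        rw [e1, e2]) (by
        intro z hz
        rw [mem_ballZ_zero] at hxb ⊢
        intro i
        have h1 := hz i
        have h2 := hxb i
        omega) xs ⟨fun i => by
          rw [hw i, hLseq]; push_cast
          exact ⟨S.D r * M * w i, by ring⟩, fun i => by omega⟩
      Finset.univ (by simpa using hd) Set.univ (by simp)
    rw [Set.inter_univ] at hreg
    refine ⟨hreg.1, ?_⟩
    have hc := count_real S r0 l0 θ d r M hl0 hθ (by omega) hSl hSr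
    rw [hsd]
    refine hc.trans ?_
    have := hreg.2
    rw [Finset.card_univ, Fintype.card_fin] at this
    exact_mod_cast this
  · rintro xs ⟨hxl, hxb⟩ x0 hx0 j hj hjd e he
    choose w hw using hxl
    obtain ⟨J, hJ, hJs⟩ := slice_coord e he
    have hreg := region S L0 r hL0 (2 * R - Ls) G hG (fun i => M * (w i - 1)) (3 * M)
      (boxI xs (-(Ls : ℤ)) (2 * Ls)) (by
        intro z
        refine forall_congr' fun i => ?_
        have e1 : ((L0 * S.D r : ℕ) : ℤ) * (M * (w i - 1)) = xs i + -(Ls : ℤ) := by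
          rw [hw i, hLseq]; push_cast; ring
        have e2 : ((L0 * S.D r : ℕ) : ℤ) * (M * (w i - 1) + (3 * M : ℕ)) = xs i + 2 * Ls := by
          rw [hw i, hLseq]; push_cast; ring
        rw [e1, e2]) (by
        intro z hz
        rw [mem_ballZ_zero] at hxb ⊢
        intro i
        have h1 := hz i
        have h2 := hxb i
        omega) x0 hx0 J (by omega) (sliceSpan x0 e) (hJs x0)
    refine ⟨hreg.1, ?_⟩
    have hc := count_real S r0 l0 θ j r (3 * M) hl0 hθ (by omega) hSl hSr
    have hsd3 : (3 * (Ls : ℝ)) / L0 = ((3 * M : ℕ) : ℝ) * S.D r := by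
      rw [mul_div_assoc, hsd]; push_cast; ring
    rw [hsd3]
    refine hc.trans ?_
    have := hreg.2
    rw [hJ] at this
    exact_mod_cast this

end Perco
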